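/- Every switch cograph is a perfect graph. -/

import Mathlib

open SimpleGraph

/-- `G` contains no induced copy of `H`. -/
def IsInducedFree {α β : Type*} (H : SimpleGraph α) (G : SimpleGraph β) : Prop :=
  IsEmpty (H ↪g G)

/-- The Gem: a path `P₄` (vertices `0-1-2-3`) together with a dominating vertex `4`. -/
def gem : SimpleGraph (Fin 5) :=
  SimpleGraph.fromRel (fun a b =>
    (a = 0 ∧ b = 1) ∨ (a = 1 ∧ b = 2) ∨ (a = 2 ∧ b = 3) ∨
    (a = 4 ∧ (b = 0 ∨ b = 1 ∨ b = 2 ∨ b = 3)))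

/-- The Bull: a triangle `0, 1, 2` with two pendant vertices `3` (adjacent to `0`)
and `4` (adjacent to `1`). -/
def bull : SimpleGraph (Fin 5) :=
  SimpleGraph.fromRel (fun a b =>
    (a = 0 ∧ b = 1) ∨ (a = 1 ∧ b = 2) ∨ (a = 0 ∧ b = 2) ∨
    (a = 3 ∧ b = 0) ∨ (a = 4 ∧ b = 1))

/-- A *switch cograph* is a graph with no induced Gem, co-Gem, Bull, or `C₅`. -/
def IsSwitchCograph {V : Type*} (G : SimpleGraph V) : Prop :=
  IsInducedFree gem G ∧ IsInducedFree gemᶜ G ∧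
    IsInducedFree bull G ∧ IsInducedFree (cycleGraph 5) G

/-- The clique number of a graph, as an extended natural number. -/
noncomputable def cliqueNumENat {W : Type*} (G : SimpleGraph W) : ℕ∞ :=
  sSup ((fun n : ℕ => (n : ℕ∞)) '' {n : ℕ | ∃ t : Finset W, G.IsNClique n t})

/-- `G` is perfect: every induced subgraph has chromatic number equal to its
clique number. -/
def IsPerfect {V : Type*} (G : SimpleGraph V) : Prop :=
  ∀ S : Set V, (G.induce S).chromaticNumber = cliqueNumENat (G.induce S)

section SwitchCographProof

/-- The five listed vertices are pairwise distinct. -/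
def Dist5 {V : Type*} (a b c d e : V) : Prop :=
  a ≠ b ∧ a ≠ c ∧ a ≠ d ∧ a ≠ e ∧ b ≠ c ∧ b ≠ d ∧ b ≠ e ∧ c ≠ d ∧ c ≠ e ∧ d ≠ e

lemma no_embedding {V : Type*} {G : SimpleGraph V} {K : SimpleGraph (Fin 5)}
    (hK : IsInducedFree K G) (a b c d e : V) (hd : Dist5 a b c d e)
    (h : ∀ i j : Fin 5, i < j → (G.Adj (![a, b, c, d, e] i) (![a, b, c, d, e] j) ↔ K.Adj i j)) :
    False := by
  refine hK.false ⟨⟨![a, b, c, d, e], ?_⟩, ?_⟩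
  · obtain ⟨h1, h2, h3, h4, h5, h6, h7, h8, h9, h10⟩ := hd
    intro i j hij
    fin_cases i <;> fin_cases j <;> simp_all
  · intro i j
    show G.Adj (![a, b, c, d, e] i) (![a, b, c, d, e] j) ↔ K.Adj i j
    rcases lt_trichotomy i j with hij | hij | hij
    · exact h i j hij
    · subst hij; simp
    · rw [G.adj_comm, K.adj_comm]; exact h j i hij

lemma gem_free {V : Type*} {G : SimpleGraph V} (hG : IsSwitchCograph G) (a b c d e : V)
    (hd : Dist5 a b c d e)
    (h : G.Adj a b ∧ ¬ G.Adj a c ∧ ¬ G.Adj a d ∧ G.Adj a e ∧ G.Adj b c ∧ ¬ G.Adj b d ∧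
      G.Adj b e ∧ G.Adj c d ∧ G.Adj c e ∧ G.Adj d e) : False := by
  refine no_embedding hG.1 a b c d e hd ?_
  obtain ⟨h1, h2, h3, h4, h5, h6, h7, h8, h9, h10⟩ := h
  intro i j hij
  fin_cases i <;> fin_cases j <;> first | (exfalso; revert hij; decide) | simp [gem, *]

lemma cogem_free {V : Type*} {G : SimpleGraph V} (hG : IsSwitchCograph G) (a b c d e : V)
    (hd : Dist5 a b c d e)
    (h : ¬ G.Adj a b ∧ G.Adj a c ∧ G.Adj a d ∧ ¬ G.Adj a e ∧ ¬ G.Adj b c ∧ G.Adj b d ∧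
      ¬ G.Adj b e ∧ ¬ G.Adj c d ∧ ¬ G.Adj c e ∧ ¬ G.Adj d e) : False := by
  refine no_embedding hG.2.1 a b c d e hd ?_
  obtain ⟨h1, h2, h3, h4, h5, h6, h7, h8, h9, h10⟩ := h
  intro i j hij
  fin_cases i <;> fin_cases j <;> first | (exfalso; revert hij; decide) | simp [gem, *]

lemma bull_free {V : Type*} {G : SimpleGraph V} (hG : IsSwitchCograph G) (a b c d e : V)
    (hd : Dist5 a b c d e)
    (h : G.Adj a b ∧ G.Adj a c ∧ G.Adj a d ∧ ¬ G.Adj a e ∧ G.Adj b c ∧ ¬ G.Adj b d ∧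
      G.Adj b e ∧ ¬ G.Adj c d ∧ ¬ G.Adj c e ∧ ¬ G.Adj d e) : False := by
  refine no_embedding hG.2.2.1 a b c d e hd ?_
  obtain ⟨h1, h2, h3, h4, h5, h6, h7, h8, h9, h10⟩ := h
  intro i j hij
  fin_cases i <;> fin_cases j <;> first | (exfalso; revert hij; decide) | simp [bull, *]

lemma c5_free {V : Type*} {G : SimpleGraph V} (hG : IsSwitchCograph G) (a b c d e : V)
    (hd : Dist5 a b c d e)
    (h : G.Adj a b ∧ ¬ G.Adj a c ∧ ¬ G.Adj a d ∧ G.Adj a e ∧ G.Adj b c ∧ ¬ G.Adj b d ∧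
      ¬ G.Adj b e ∧ G.Adj c d ∧ ¬ G.Adj c e ∧ G.Adj d e) : False := by
  refine no_embedding hG.2.2.2 a b c d e hd ?_
  obtain ⟨h1, h2, h3, h4, h5, h6, h7, h8, h9, h10⟩ := h
  have hc : ∀ i j : Fin 5, (cycleGraph 5).Adj i j ↔ (i - j = 1 ∨ j - i = 1) := by
    intro i j
    exact cycleGraph_adj
  intro i j hij
  rw [hc]
  fin_cases i <;> fin_cases j <;>
    first | (exfalso; revert hij; decide) | (simp [*]; done) | (simp [*]; decide)

/-- `H` has no induced path on four vertices. -/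
def PathFree {V : Type*} (H : SimpleGraph V) : Prop :=
  ∀ a b c d : V, H.Adj a b → H.Adj b c → H.Adj c d →
    ¬ H.Adj a c → ¬ H.Adj a d → ¬ H.Adj b d → a ≠ c → a ≠ d → b ≠ d → False

/-- Seidel switching of `G` with respect to the vertex set `A`. -/
def seidel {V : Type*} (G : SimpleGraph V) (A : Set V) : SimpleGraph V where
  Adj x y := x ≠ y ∧ (G.Adj x y ↔ (x ∈ A ↔ y ∈ A))
  symm := ⟨fun x y h => ⟨h.1.symm, by rw [G.adj_comm]; tauto⟩⟩
  loopless := ⟨fun x h => h.1 rfl⟩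

lemma exists_seidel {V : Type*} (G : SimpleGraph V) (hG : IsSwitchCograph G) :
    ∃ A : Set V, PathFree (seidel G A) := by
  rcases isEmpty_or_nonempty V with hV | ⟨⟨v⟩⟩
  · exact ⟨∅, fun a => (hV.false a).elim⟩
  refine ⟨G.neighborSet v, ?_⟩
  intro a b c d hab hbc hcd hac had hbd nac nad nbd
  have hv : ∀ x, ¬ (seidel G (G.neighborSet v)).Adj v x := by
    intro x hx
    have := hx.2
    simp at this
  have va : v ≠ a := by rintro rfl; exact hv _ hab
  have vb : v ≠ b := by rintro rfl; exact hv _ hbc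
  have vc : v ≠ c := by rintro rfl; exact hv _ hcd
  have vd : v ≠ d := by rintro rfl; exact hv _ hcd.symm
  have nab := hab.ne
  have nbc := hbc.ne
  have ncd := hcd.ne
  simp only [seidel, mem_neighborSet, ne_eq, nab, nbc, ncd, nac, nad, nbd, not_false_eq_true,
    true_and] at hab hbc hcd hac had hbd
  clear hv
  by_cases ha : G.Adj v a <;> by_cases hb : G.Adj v b <;> by_cases hc : G.Adj v c <;>
    by_cases hd : G.Adj v d <;>
    simp only [ha, hb, hc, hd, iff_true, iff_false, iff_self, not_not] at hab hbc hcd hac had hbd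
  · exact gem_free hG a b c d v (by simp only [Dist5]; grind) (by grind [G.adj_comm])
  · exact gem_free hG c v a d b (by simp only [Dist5]; grind) (by grind [G.adj_comm])
  · exact bull_free hG a v b c d (by simp only [Dist5]; grind) (by grind [G.adj_comm])
  · exact gem_free hG c d b v a (by simp only [Dist5]; grind) (by grind [G.adj_comm])
  · exact bull_free hG d v c b a (by simp only [Dist5]; grind) (by grind [G.adj_comm])
  · exact cogem_free hG a c d v b (by simp only [Dist5]; grind) (by grind [G.adj_comm])
  · exact c5_free hG a c b d v (by simp only [Dist5]; grind) (by grind [G.adj_comm])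
  · exact bull_free hG a c d v b (by simp only [Dist5]; grind) (by grind [G.adj_comm])
  · exact gem_free hG a d v b c (by simp only [Dist5]; grind) (by grind [G.adj_comm])
  · exact bull_free hG b c v d a (by simp only [Dist5]; grind) (by grind [G.adj_comm])
  · exact cogem_free hG d b a v c (by simp only [Dist5]; grind) (by grind [G.adj_comm])
  · exact cogem_free hG b c v d a (by simp only [Dist5]; grind) (by grind [G.adj_comm])
  · exact gem_free hG b a c v d (by simp only [Dist5]; grind) (by grind [G.adj_comm])
  · exact cogem_free hG a v b c d (by simp only [Dist5]; grind) (by grind [G.adj_comm])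
  · exact bull_free hG b d a c v (by simp only [Dist5]; grind) (by grind [G.adj_comm])
  · exact cogem_free hG b d a c v (by simp only [Dist5]; grind) (by grind [G.adj_comm])

/-- The finite vertex set `S` splits into two nonempty parts which are
completely joined or completely non-adjacent in `H`. -/
def Splits {V : Type*} [DecidableEq V] (H : SimpleGraph V) (S : Finset V) : Prop :=
  ∃ S₁ S₂ : Finset V, S₁.Nonempty ∧ S₂.Nonempty ∧ Disjoint S₁ S₂ ∧ S₁ ∪ S₂ = S ∧
    ((∀ x ∈ S₁, ∀ y ∈ S₂, ¬ H.Adj x y) ∨ (∀ x ∈ S₁, ∀ y ∈ S₂, H.Adj x y))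

lemma PathFree.compl {V : Type*} {H : SimpleGraph V} (h : PathFree H) : PathFree Hᶜ := by
  intro a b c d hab hbc hcd hac had hbd nac nad nbd
  have nab := hab.ne
  have nbc := hbc.ne
  have ncd := hcd.ne
  simp only [SimpleGraph.compl_adj, ne_eq, not_and, not_not] at hab hbc hcd hac had hbd
  refine h b d a c (hbd nbd) (had nad).symm (hac nac) ?_ ?_ ?_ ?_ ?_ ?_ <;>
    grind [SimpleGraph.adj_comm]

lemma Splits.of_compl {V : Type*} [DecidableEq V] {H : SimpleGraph V} {S : Finset V}
    (h : Splits Hᶜ S) : Splits H S := by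
  obtain ⟨S₁, S₂, h1, h2, hd, hu, h⟩ := h
  refine ⟨S₁, S₂, h1, h2, hd, hu, ?_⟩
  have hne : ∀ x ∈ S₁, ∀ y ∈ S₂, x ≠ y := fun x hx y hy e =>
    Finset.disjoint_left.1 hd hx (e ▸ hy)
  simp only [SimpleGraph.compl_adj] at h
  rcases h with h | h
  · right; intro x hx y hy
    have := h x hx y hy
    have := hne x hx y hy
    tauto
  · left; intro x hx y hy
    exact (h x hx y hy).2

lemma splits_insert_aux {V : Type*} [DecidableEq V] {H : SimpleGraph V} (hP : PathFree H)
    (v : V) (S₁ S₂ : Finset V) (h1 : S₁.Nonempty) (h2 : S₂.Nonempty) (hd : Disjoint S₁ S₂)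
    (hv1 : v ∉ S₁) (hv2 : v ∉ S₂) (h : ∀ x ∈ S₁, ∀ y ∈ S₂, ¬ H.Adj x y)
    (u : V) (hu : u ∈ S₁) (hvu : ¬ H.Adj v u) : Splits H (insert v (S₁ ∪ S₂)) := by
  classical
  rw [Finset.disjoint_left] at hd
  by_cases hz : ∃ z ∈ S₂, H.Adj v z
  · obtain ⟨z, hz, hvz⟩ := hz
    refine ⟨S₁.filter (fun x => ¬ H.Adj v x), insert v (S₁.filter (fun x => H.Adj v x) ∪ S₂),
      ⟨u, by simp [hu, hvu]⟩, ⟨v, by simp⟩, ?_, ?_, Or.inl ?_⟩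
    · rw [Finset.disjoint_left]; grind
    · ext x; grind
    · intro x hx y hy hxy
      simp only [Finset.mem_filter, Finset.mem_insert, Finset.mem_union] at hx hy
      obtain ⟨hx, hvx⟩ := hx
      rcases hy with rfl | ⟨hy, hvy⟩ | hy
      · exact hvx hxy.symm
      · exact hP x y v z hxy hvy.symm hvz (fun e => hvx e.symm) (h x hx z hz) (h y hy z hz)
          (by grind) (by grind) (by grind)
      · exact h x hx y hy hxy
  · refine ⟨insert v S₁, S₂, ⟨v, by simp⟩, h2, ?_, ?_, Or.inl ?_⟩
    · rw [Finset.disjoint_left]; grind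
    · ext x; grind
    · intro x hx y hy hxy
      rcases Finset.mem_insert.1 hx with rfl | hx
      · exact hz ⟨y, hy, hxy⟩
      · exact h x hx y hy hxy

lemma splits_insert {V : Type*} [DecidableEq V] {H : SimpleGraph V} (hP : PathFree H)
    (v : V) (S₁ S₂ : Finset V) (h1 : S₁.Nonempty) (h2 : S₂.Nonempty) (hd : Disjoint S₁ S₂)
    (hv1 : v ∉ S₁) (hv2 : v ∉ S₂) (h : ∀ x ∈ S₁, ∀ y ∈ S₂, ¬ H.Adj x y) :
    Splits H (insert v (S₁ ∪ S₂)) := by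
  by_cases hu : ∃ u ∈ S₁ ∪ S₂, ¬ H.Adj v u
  · obtain ⟨u, hu, hvu⟩ := hu
    rcases Finset.mem_union.1 hu with hu | hu
    · exact splits_insert_aux hP v S₁ S₂ h1 h2 hd hv1 hv2 h u hu hvu
    · rw [Finset.union_comm]
      exact splits_insert_aux hP v S₂ S₁ h2 h1 hd.symm hv2 hv1
        (fun x hx y hy e => h y hy x hx e.symm) u hu hvu
  · push Not at hu
    refine ⟨{v}, S₁ ∪ S₂, by simp, h1.mono Finset.subset_union_left, by simp [hv1, hv2], rfl,
      Or.inr ?_⟩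
    intro x hx y hy
    rw [Finset.mem_singleton.1 hx]
    exact hu y hy

lemma PathFree.splits {V : Type*} [DecidableEq V] {H : SimpleGraph V} (hP : PathFree H)
    (S : Finset V) (hS : 2 ≤ S.card) : Splits H S := by
  induction S using Finset.induction_on with
  | empty => simp at hS
  | insert v S hv ih =>
    rcases Nat.lt_or_ge S.card 2 with hc | hc
    · have : S.card = 1 := by
        rw [Finset.card_insert_of_notMem hv] at hS; omega
      obtain ⟨u, rfl⟩ := Finset.card_eq_one.1 this
      refine ⟨{v}, {u}, by simp, by simp, by simpa using hv, rfl, ?_⟩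
      by_cases huv : H.Adj v u
      · right; simpa using huv
      · left; simpa using huv
    · obtain ⟨S₁, S₂, h1, h2, hd, rfl, h⟩ := ih hc
      simp only [Finset.mem_union, not_or] at hv
      rcases h with h | h
      · exact splits_insert hP v S₁ S₂ h1 h2 hd hv.1 hv.2 h
      · refine Splits.of_compl (splits_insert hP.compl v S₁ S₂ h1 h2 hd hv.1 hv.2 ?_)
        intro x hx y hy hxy
        exact hxy.2 (h x hx y hy)

lemma pick {P Z : Finset ℕ} (h : P ⊆ Z) {n : ℕ} (hn : n ≤ Z.card) :
    ∃ T ⊆ Z, T.card = n ∧ (T ⊆ P ∨ P ⊆ T) := by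
  rcases le_total n P.card with hc | hc
  · obtain ⟨T, hT, hTn⟩ := Finset.exists_subset_card_eq hc
    exact ⟨T, hT.trans h, hTn, Or.inl hT⟩
  · obtain ⟨T, hPT, hT, hTn⟩ := Finset.exists_subsuperset_card_eq h hc hn
    exact ⟨T, hT, hTn, Or.inr hPT⟩

/-- Splitting two palettes for a union in the switched graph, disjoint sizes. -/
lemma palette_disjoint (X Y : Finset ℕ) (a b : ℕ) (ha : a ≤ X.card) (hb : b ≤ Y.card)
    (hab : a + b ≤ (X ∪ Y).card) :
    ∃ X' ⊆ X, ∃ Y' ⊆ Y, Disjoint X' Y' ∧ X'.card = a ∧ Y'.card = b ∧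
      a + b = (X' ∪ Y').card ∧ b ≤ (Y \ X').card ∧ a ≤ (X \ Y').card ∧
      (X \ Y' ∪ Y \ X') = X ∪ Y ∧
      (∀ c, c ≤ Y.card → a + c ≤ (X ∪ Y).card → c ≤ (Y \ X').card) ∧
      (∀ c, c ≤ X.card → b + c ≤ (X ∪ Y).card → c ≤ (X \ Y').card) := by
  obtain ⟨X', hX', hXa, hXc⟩ := pick (P := X \ Y) Finset.sdiff_subset ha
  have hu : (X ∪ Y).card = (X \ Y).card + Y.card := (Finset.card_sdiff_add_card X Y).symm
  have k1 : ∀ c, c ≤ Y.card → a + c ≤ (X ∪ Y).card → c ≤ (Y \ X').card := by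
    intro c hc hac
    rcases hXc with h | h
    · have : Y \ X' = Y := by ext x; grind
      rwa [this]
    · have : X' ∪ (Y \ X') = X ∪ Y := by ext x; grind
      have h2 := Finset.card_union_le X' (Y \ X')
      rw [this] at h2; omega
  have k2 := k1 b hb hab
  obtain ⟨Y', hY', hYb, hYc⟩ := pick (P := Y \ X) (Z := Y \ X') (n := b)
    (by intro x hx; grind) k2
  have k3 : ∀ c, c ≤ X.card → b + c ≤ (X ∪ Y).card → c ≤ (X \ Y').card := by
    intro c hc hac
    rcases hYc with h | h
    · have : X \ Y' = X := by ext x; grind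
      rwa [this]
    · have : Y' ∪ (X \ Y') = X ∪ Y := by ext x; grind
      have h2 := Finset.card_union_le Y' (X \ Y')
      rw [this] at h2; omega
  have hdis : Disjoint X' Y' := by rw [Finset.disjoint_left]; grind
  refine ⟨X', hX', Y', by grind, hdis, hXa, hYb, ?_, k2,
    k3 a ha (by omega), ?_, k1, k3⟩
  · rw [Finset.card_union_of_disjoint hdis]; omega
  · ext x; grind

/-- Palettes for the case `A₁`-`B₂` and `A₂`-`B₁` complete. -/
lemma palette_union (X Y : Finset ℕ) (a1 a2 b1 b2 w1 w2 : ℕ)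
    (ha1 : a1 ≤ X.card) (ha2 : a2 ≤ X.card) (hb1 : b1 ≤ Y.card) (hb2 : b2 ≤ Y.card)
    (hw1 : w1 ≤ (X ∪ Y).card) (hw2 : w2 ≤ (X ∪ Y).card)
    (h12 : a1 + b2 ≤ (X ∪ Y).card) (h21 : a2 + b1 ≤ (X ∪ Y).card)
    (hs1 : w1 ≤ a1 + b1) (hs2 : w2 ≤ a2 + b2) :
    ∃ X1 ⊆ X, ∃ X2 ⊆ X, ∃ Y1 ⊆ Y, ∃ Y2 ⊆ Y, Disjoint X1 Y2 ∧ Disjoint X2 Y1 ∧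
      a1 ≤ X1.card ∧ a2 ≤ X2.card ∧ b1 ≤ Y1.card ∧ b2 ≤ Y2.card ∧
      w1 ≤ (X1 ∪ Y1).card ∧ w2 ≤ (X2 ∪ Y2).card := by
  rcases Nat.lt_or_ge (X ∪ Y).card (a1 + b1) with h1 | h1
  · obtain ⟨X2, hX2, Y2, hY2, hd, e1, e2, e3, -, -, e6, e7, e8⟩ :=
      palette_disjoint X Y a2 b2 ha2 hb2 (by omega)
    refine ⟨X \ Y2, by grind, X2, hX2, Y \ X2, by grind, Y2, hY2, Finset.sdiff_disjoint,
      Finset.disjoint_sdiff, e8 _ ha1 (by omega), e1.ge, e7 _ hb1 (by omega), e2.ge,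
      by rw [e6]; omega, by omega⟩
  · rcases Nat.lt_or_ge (X ∪ Y).card (a2 + b2) with h2 | h2
    · obtain ⟨X1, hX1, Y1, hY1, hd, e1, e2, e3, -, -, e6, e7, e8⟩ :=
        palette_disjoint X Y a1 b1 ha1 hb1 (by omega)
      refine ⟨X1, hX1, X \ Y1, by grind, Y1, hY1, Y \ X1, by grind, Finset.disjoint_sdiff,
        Finset.sdiff_disjoint, e1.ge, e8 _ ha2 (by omega), e2.ge, e7 _ hb2 (by omega),
        by omega, by rw [e6]; omega⟩
    · obtain ⟨X', hX, Y', hY, hd, e1, e2, e3, -⟩ :=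
        palette_disjoint X Y (max a1 a2) (max b1 b2) (by omega) (by omega) (by omega)
      exact ⟨X', hX, X', hX, Y', hY, Y', hY, hd, hd, by omega, by omega, by omega, by omega,
        by omega, by omega⟩

lemma palette_join_aux (X Y : Finset ℕ) (a1 a2 b1 b2 w1 w2 : ℕ)
    (ha : a1 + a2 ≤ X.card) (hb : b1 + b2 ≤ Y.card)
    (hw1 : w1 ≤ (X ∪ Y).card) (hs2 : w2 ≤ a2 + b2) (h1 : (X ∪ Y).card < a1 + b1) :
    ∃ X1 ⊆ X, ∃ X2 ⊆ X, ∃ Y1 ⊆ Y, ∃ Y2 ⊆ Y, Disjoint X1 X2 ∧ Disjoint Y1 Y2 ∧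
      a1 ≤ X1.card ∧ a2 ≤ X2.card ∧ b1 ≤ Y1.card ∧ b2 ≤ Y2.card ∧
      w1 ≤ (X1 ∪ Y1).card ∧ w2 ≤ (X2 ∪ Y2).card := by
  have hq := Finset.card_union_add_card_inter X Y
  obtain ⟨X2, hX2, e2⟩ := Finset.exists_subset_card_eq (s := X ∩ Y) (n := a2) (by omega)
  have := Finset.card_sdiff_of_subset hX2
  obtain ⟨Y2, hY2, f2⟩ := Finset.exists_subset_card_eq (s := (X ∩ Y) \ X2) (n := b2) (by omega)
  have hX2' : X2 ⊆ X := by grind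
  have hY2' : Y2 ⊆ Y := by intro x hx; have := hY2 hx; grind
  have hd : Disjoint X2 Y2 := by
    rw [Finset.disjoint_left]; intro x hx hx'; have := hY2 hx'; grind
  refine ⟨X \ X2, by grind, X2, hX2', Y \ Y2, by grind, Y2, hY2', Finset.sdiff_disjoint,
    Finset.sdiff_disjoint, ?_, e2.ge, ?_, f2.ge, ?_, ?_⟩
  · rw [Finset.card_sdiff_of_subset hX2']; omega
  · rw [Finset.card_sdiff_of_subset hY2']; omega
  · have : X \ X2 ∪ Y \ Y2 = X ∪ Y := by
      rw [Finset.disjoint_left] at hd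
      ext x
      have h1 := @hX2 x
      have h2 := @hY2 x
      grind
    rwa [this]
  · rw [Finset.card_union_of_disjoint hd]; omega

/-- Palettes for the case `A₁`-`A₂` and `B₁`-`B₂` complete. -/
lemma palette_join (X Y : Finset ℕ) (a1 a2 b1 b2 w1 w2 : ℕ)
    (ha : a1 + a2 ≤ X.card) (hb : b1 + b2 ≤ Y.card)
    (hw1 : w1 ≤ (X ∪ Y).card) (hw2 : w2 ≤ (X ∪ Y).card)
    (hs1 : w1 ≤ a1 + b1) (hs2 : w2 ≤ a2 + b2) :
    ∃ X1 ⊆ X, ∃ X2 ⊆ X, ∃ Y1 ⊆ Y, ∃ Y2 ⊆ Y, Disjoint X1 X2 ∧ Disjoint Y1 Y2 ∧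
      a1 ≤ X1.card ∧ a2 ≤ X2.card ∧ b1 ≤ Y1.card ∧ b2 ≤ Y2.card ∧
      w1 ≤ (X1 ∪ Y1).card ∧ w2 ≤ (X2 ∪ Y2).card := by
  rcases Nat.lt_or_ge (X ∪ Y).card (a1 + b1) with h1 | h1
  · exact palette_join_aux X Y a1 a2 b1 b2 w1 w2 ha hb hw1 hs2 h1
  rcases Nat.lt_or_ge (X ∪ Y).card (a2 + b2) with h2 | h2
  · obtain ⟨X2, x2, X1, x1, Y2, y2, Y1, y1, d1, d2, g⟩ :=
      palette_join_aux X Y a2 a1 b2 b1 w2 w1 (by omega) (by omega) hw2 hs1 h2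
    exact ⟨X1, x1, X2, x2, Y1, y1, Y2, y2, d1.symm, d2.symm, by tauto⟩
  have c1 : (X \ Y).card + (X ∩ Y).card = X.card := Finset.card_sdiff_add_card_inter X Y
  have c2 : (Y \ X).card + (X ∩ Y).card = Y.card := by
    rw [Finset.inter_comm]; exact Finset.card_sdiff_add_card_inter Y X
  have c3 := Finset.card_union_add_card_inter X Y
  obtain ⟨Q, hQ, hq⟩ := Finset.exists_subset_card_eq (s := X ∩ Y)
    (n := max (a1 - (X \ Y).card) (b2 - (Y \ X).card)) (by omega)
  have hQX : Q ⊆ X := by grind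
  have hQY : Q ⊆ Y := by grind
  have u1 : (X \ Y ∪ Q).card = (X \ Y).card + Q.card := by
    apply Finset.card_union_of_disjoint
    rw [Finset.disjoint_left]; grind
  have u2 : (Y \ X ∪ Q).card = (Y \ X).card + Q.card := by
    apply Finset.card_union_of_disjoint
    rw [Finset.disjoint_left]; grind
  obtain ⟨X1, hX1, e1, k1⟩ := pick (P := Q) (Z := X \ Y ∪ Q) (n := a1) (by grind) (by omega)
  obtain ⟨Y2, hY2, f2, k2⟩ := pick (P := Q) (Z := Y \ X ∪ Q) (n := b2) (by grind) (by omega)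
  have hX1' : X1 ⊆ X := by intro x hx; have := hX1 hx; grind
  have hY2' : Y2 ⊆ Y := by intro x hx; have := hY2 hx; grind
  have l1 : a2 ≤ (X \ (X1 ∪ Q)).card := by
    rcases k1 with k | k
    · rw [Finset.union_eq_right.2 k, Finset.card_sdiff_of_subset hQX]; omega
    · rw [Finset.union_eq_left.2 k, Finset.card_sdiff_of_subset hX1']; omega
  have l2 : b1 ≤ (Y \ (Y2 ∪ Q)).card := by
    rcases k2 with k | k
    · rw [Finset.union_eq_right.2 k, Finset.card_sdiff_of_subset hQY]; omega
    · rw [Finset.union_eq_left.2 k, Finset.card_sdiff_of_subset hY2']; omega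
  have d1 : Disjoint X1 (Y \ (Y2 ∪ Q)) := by
    rw [Finset.disjoint_left]; intro x hx; have := hX1 hx; grind
  have d2 : Disjoint (X \ (X1 ∪ Q)) Y2 := by
    rw [Finset.disjoint_left]; intro x hx hx'; have := hY2 hx'; grind
  refine ⟨X1, hX1', X \ (X1 ∪ Q), by grind, Y \ (Y2 ∪ Q), by grind, Y2, hY2', ?_, ?_,
    e1.ge, l1, l2, f2.ge, ?_, ?_⟩
  · rw [Finset.disjoint_left]; grind
  · rw [Finset.disjoint_left]; grind
  · rw [Finset.card_union_of_disjoint d1]; omega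
  · rw [Finset.card_union_of_disjoint d2]; omega

open Classical in
/-- The maximum size of a clique of `G` inside the finite set `S`. -/
noncomputable def cliqueMax {V : Type*} (G : SimpleGraph V) (S : Finset V) : ℕ :=
  (S.powerset.filter (fun t : Finset V => G.IsClique (t : Set V))).sup Finset.card

lemma card_le_cliqueMax {V : Type*} {G : SimpleGraph V} {S t : Finset V} (ht : t ⊆ S)
    (hc : G.IsClique (t : Set V)) : t.card ≤ cliqueMax G S := by
  classical
  unfold cliqueMax
  exact Finset.le_sup (f := Finset.card) (by simp [ht, hc])

lemma exists_cliqueMax {V : Type*} (G : SimpleGraph V) (S : Finset V) :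
    ∃ t ⊆ S, G.IsClique (t : Set V) ∧ t.card = cliqueMax G S := by
  classical
  have hne : (S.powerset.filter (fun t : Finset V => G.IsClique (t : Set V))).Nonempty :=
    ⟨∅, by simp⟩
  obtain ⟨t, ht, h⟩ := Finset.exists_mem_eq_sup _ hne Finset.card
  simp only [Finset.mem_filter, Finset.mem_powerset] at ht
  refine ⟨t, ht.1, ht.2, ?_⟩
  unfold cliqueMax
  rw [← h]

lemma cliqueMax_mono {V : Type*} {G : SimpleGraph V} {S T : Finset V} (h : S ⊆ T) :
    cliqueMax G S ≤ cliqueMax G T := by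
  obtain ⟨t, ht, hc, e⟩ := exists_cliqueMax G S
  rw [← e]
  exact card_le_cliqueMax (ht.trans h) hc

lemma cliqueMax_union_le {V : Type*} [DecidableEq V] {G : SimpleGraph V} {S T U : Finset V}
    (h : U ⊆ S ∪ T) : cliqueMax G U ≤ cliqueMax G S + cliqueMax G T := by
  obtain ⟨t, ht, hc, e⟩ := exists_cliqueMax G U
  rw [← e]
  have h1 : (t ∩ S).card ≤ cliqueMax G S :=
    card_le_cliqueMax Finset.inter_subset_right (hc.subset (by simp))
  have h2 : (t ∩ T).card ≤ cliqueMax G T :=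
    card_le_cliqueMax Finset.inter_subset_right (hc.subset (by simp))
  have h3 : t ⊆ (t ∩ S) ∪ (t ∩ T) := by
    intro x hx
    have := h (ht hx)
    grind
  have := (Finset.card_le_card h3).trans (Finset.card_union_le _ _)
  omega

lemma add_le_cliqueMax {V : Type*} [DecidableEq V] {G : SimpleGraph V} {S T U : Finset V}
    (hS : S ⊆ U) (hT : T ⊆ U) (h : ∀ x ∈ S, ∀ y ∈ T, G.Adj x y) :
    cliqueMax G S + cliqueMax G T ≤ cliqueMax G U := by
  obtain ⟨s, hs, hsc, e1⟩ := exists_cliqueMax G S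
  obtain ⟨t, ht, htc, e2⟩ := exists_cliqueMax G T
  rw [← e1, ← e2]
  have hd : Disjoint s t := by
    rw [Finset.disjoint_left]
    intro x hx hx'
    exact (h x (hs hx) x (ht hx')).ne rfl
  rw [← Finset.card_union_of_disjoint hd]
  refine card_le_cliqueMax (Finset.union_subset (hs.trans hS) (ht.trans hT)) ?_
  intro x hx y hy hxy
  simp only [Finset.coe_union, Set.mem_union, Finset.mem_coe] at hx hy
  rcases hx with hx | hx <;> rcases hy with hy | hy
  · exact hsc hx hy hxy
  · exact h x (hs hx) y (ht hy)
  · exact (h y (hs hy) x (ht hx)).symm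
  · exact htc hx hy hxy

open Classical in
/-- `G[S]` with the bipartition given by `A` can be properly coloured from palettes `X` (on `A`)
and `Y` (off `A`) whenever the obvious clique conditions hold. -/
def Colors {V : Type*} (G : SimpleGraph V) (A : Set V) (S : Finset V) : Prop :=
  ∀ X Y : Finset ℕ, cliqueMax G (S.filter (· ∈ A)) ≤ X.card →
    cliqueMax G (S.filter (· ∉ A)) ≤ Y.card → cliqueMax G S ≤ (X ∪ Y).card →
    ∃ f : V → ℕ, (∀ x ∈ S, x ∈ A → f x ∈ X) ∧ (∀ x ∈ S, x ∉ A → f x ∈ Y) ∧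
      ∀ x ∈ S, ∀ y ∈ S, G.Adj x y → f x ≠ f y

lemma glue {V : Type*} [DecidableEq V] {G : SimpleGraph V} {S₁ S₂ : Finset V}
    (hd : Disjoint S₁ S₂) (f g : V → ℕ)
    (hf : ∀ x ∈ S₁, ∀ y ∈ S₁, G.Adj x y → f x ≠ f y)
    (hg : ∀ x ∈ S₂, ∀ y ∈ S₂, G.Adj x y → g x ≠ g y)
    (hfg : ∀ x ∈ S₁, ∀ y ∈ S₂, G.Adj x y → f x ≠ g y) :
    ∃ k : V → ℕ, (∀ x ∈ S₁, k x = f x) ∧ (∀ x ∈ S₂, k x = g x) ∧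
      ∀ x ∈ S₁ ∪ S₂, ∀ y ∈ S₁ ∪ S₂, G.Adj x y → k x ≠ k y := by
  classical
  rw [Finset.disjoint_left] at hd
  refine ⟨fun x => if x ∈ S₁ then f x else g x, ?_, ?_, ?_⟩
  · intro x hx; simp [hx]
  · intro x hx
    have : x ∉ S₁ := fun h => hd h hx
    simp [this]
  · intro x hx y hy hxy
    rcases Finset.mem_union.1 hx with hx | hx <;> rcases Finset.mem_union.1 hy with hy | hy
    · simpa [hx, hy] using hf x hx y hy hxy
    · have : y ∉ S₁ := fun h => hd h hy
      simpa [hx, this] using hfg x hx y hy hxy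
    · have : x ∉ S₁ := fun h => hd h hx
      simpa [hy, this] using (hfg y hy x hx hxy.symm).symm
    · have h1 : y ∉ S₁ := fun h => hd h hy
      have h2 : x ∉ S₁ := fun h => hd h hx
      simpa [h1, h2] using hg x hx y hy hxy

lemma seidel_adj {V : Type*} {G : SimpleGraph V} {A : Set V} {x y : V} (hne : x ≠ y) :
    (seidel G A).Adj x y ↔ (G.Adj x y ↔ (x ∈ A ↔ y ∈ A)) := by
  simp [seidel, hne]

set_option maxHeartbeats 1000000 in
lemma colors_all {V : Type*} [DecidableEq V] (G : SimpleGraph V) (A : Set V)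
    (hP : PathFree (seidel G A)) (S : Finset V) : Colors G A S := by
  classical
  induction S using Finset.strongInduction with
  | H S ih =>
  rcases Nat.lt_or_ge S.card 2 with hc | hc
  · intro X Y hX hY _
    rcases S.eq_empty_or_nonempty with rfl | ⟨s, hs⟩
    · exact ⟨fun _ => 0, by simp, by simp, by simp⟩
    have hS : ∀ x ∈ S, x = s := fun x hx => Finset.card_le_one.1 (by omega) x hx s hs
    have hcl : G.IsClique (({s} : Finset V) : Set V) := by simp
    have hprop : ∀ n : ℕ, ∀ x ∈ S, ∀ y ∈ S, G.Adj x y → (fun _ : V => n) x ≠ (fun _ => n) y := by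
      intro n x hx y hy hxy
      exact absurd ((hS x hx).trans (hS y hy).symm) hxy.ne
    by_cases hA : s ∈ A
    · have h1 := card_le_cliqueMax (S := S.filter (· ∈ A)) (by simp [hs, hA]) hcl
      obtain ⟨n, hn⟩ : X.Nonempty := by
        rw [← Finset.card_pos]; simp at h1; omega
      refine ⟨fun _ => n, fun _ _ _ => hn, fun x hx hxA => ?_, hprop n⟩
      rw [hS x hx] at hxA; exact absurd hA hxA
    · have h1 := card_le_cliqueMax (S := S.filter (· ∉ A)) (by simp [hs, hA]) hcl
      obtain ⟨n, hn⟩ : Y.Nonempty := by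
        rw [← Finset.card_pos]; simp at h1; omega
      refine ⟨fun _ => n, fun x hx hxA => ?_, fun _ _ _ => hn, hprop n⟩
      rw [hS x hx] at hxA; exact absurd hxA hA
  obtain ⟨S₁, S₂, ⟨s1, hs1⟩, ⟨s2, hs2⟩, hd, hu, hsp⟩ := hP.splits S hc
  have hd' := Finset.disjoint_left.1 hd
  have hne : ∀ x ∈ S₁, ∀ y ∈ S₂, x ≠ y := fun x hx y hy e => hd' hx (e ▸ hy)
  have hsub1 : S₁ ⊆ S := hu ▸ Finset.subset_union_left
  have hsub2 : S₂ ⊆ S := hu ▸ Finset.subset_union_right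
  have ih1 := ih S₁ ⟨hsub1, fun h => hd' (h (hsub2 hs2)) hs2⟩
  have ih2 := ih S₂ ⟨hsub2, fun h => hd' hs1 (h (hsub1 hs1))⟩
  intro X Y hX hY hXY
  have m1 := (cliqueMax_mono (G := G) (Finset.filter_subset_filter (· ∈ A) hsub1)).trans hX
  have m2 := (cliqueMax_mono (G := G) (Finset.filter_subset_filter (· ∈ A) hsub2)).trans hX
  have n1 := (cliqueMax_mono (G := G) (Finset.filter_subset_filter (· ∉ A) hsub1)).trans hY
  have n2 := (cliqueMax_mono (G := G) (Finset.filter_subset_filter (· ∉ A) hsub2)).trans hY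
  have w1 := (cliqueMax_mono (G := G) hsub1).trans hXY
  have w2 := (cliqueMax_mono (G := G) hsub2).trans hXY
  have t1 : cliqueMax G S₁ ≤ cliqueMax G (S₁.filter (· ∈ A)) + cliqueMax G (S₁.filter (· ∉ A)) :=
    cliqueMax_union_le (by rw [Finset.filter_union_filter_not_eq])
  have t2 : cliqueMax G S₂ ≤ cliqueMax G (S₂.filter (· ∈ A)) + cliqueMax G (S₂.filter (· ∉ A)) :=
    cliqueMax_union_le (by rw [Finset.filter_union_filter_not_eq])
  have finish : ∀ X1 ⊆ X, ∀ X2 ⊆ X, ∀ Y1 ⊆ Y, ∀ Y2 ⊆ Y,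
      cliqueMax G (S₁.filter (· ∈ A)) ≤ X1.card → cliqueMax G (S₂.filter (· ∈ A)) ≤ X2.card →
      cliqueMax G (S₁.filter (· ∉ A)) ≤ Y1.card → cliqueMax G (S₂.filter (· ∉ A)) ≤ Y2.card →
      cliqueMax G S₁ ≤ (X1 ∪ Y1).card → cliqueMax G S₂ ≤ (X2 ∪ Y2).card →
      (∀ x ∈ S₁, ∀ y ∈ S₂, G.Adj x y → ∀ n m : ℕ, (x ∈ A → n ∈ X1) → (x ∉ A → n ∈ Y1) →
        (y ∈ A → m ∈ X2) → (y ∉ A → m ∈ Y2) → n ≠ m) →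
      ∃ f : V → ℕ, (∀ x ∈ S, x ∈ A → f x ∈ X) ∧ (∀ x ∈ S, x ∉ A → f x ∈ Y) ∧
        ∀ x ∈ S, ∀ y ∈ S, G.Adj x y → f x ≠ f y := by
    intro X1 hX1 X2 hX2 Y1 hY1 Y2 hY2 p1 p2 p3 p4 p5 p6 hcross
    obtain ⟨f, f1, f2, f3⟩ := ih1 X1 Y1 p1 p3 p5
    obtain ⟨g, g1, g2, g3⟩ := ih2 X2 Y2 p2 p4 p6
    obtain ⟨k, k1, k2, k3⟩ := glue (G := G) hd f g f3 g3 (fun x hx y hy hxy =>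
      hcross x hx y hy hxy _ _ (f1 x hx) (f2 x hx) (g1 y hy) (g2 y hy))
    rw [hu] at k3
    refine ⟨k, ?_, ?_, k3⟩
    · intro x hx hA
      rw [← hu] at hx
      rcases Finset.mem_union.1 hx with hx | hx
      · rw [k1 x hx]; exact hX1 (f1 x hx hA)
      · rw [k2 x hx]; exact hX2 (g1 x hx hA)
    · intro x hx hA
      rw [← hu] at hx
      rcases Finset.mem_union.1 hx with hx | hx
      · rw [k1 x hx]; exact hY1 (f2 x hx hA)
      · rw [k2 x hx]; exact hY2 (g2 x hx hA)
  rcases hsp with hsp | hsp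
  · have hadj : ∀ x ∈ S₁, ∀ y ∈ S₂, (G.Adj x y ↔ ¬ (x ∈ A ↔ y ∈ A)) := by
      intro x hx y hy
      have := hsp x hx y hy
      rw [seidel_adj (hne x hx y hy)] at this
      tauto
    have q1 : cliqueMax G (S₁.filter (· ∈ A)) + cliqueMax G (S₂.filter (· ∉ A)) ≤ cliqueMax G S := by
      refine add_le_cliqueMax ((Finset.filter_subset _ _).trans hsub1)
        ((Finset.filter_subset _ _).trans hsub2) ?_
      intro x hx y hy
      rw [Finset.mem_filter] at hx hy
      rw [hadj x hx.1 y hy.1]; tauto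
    have q2 : cliqueMax G (S₁.filter (· ∉ A)) + cliqueMax G (S₂.filter (· ∈ A)) ≤ cliqueMax G S := by
      refine add_le_cliqueMax ((Finset.filter_subset _ _).trans hsub1)
        ((Finset.filter_subset _ _).trans hsub2) ?_
      intro x hx y hy
      rw [Finset.mem_filter] at hx hy
      rw [hadj x hx.1 y hy.1]; tauto
    obtain ⟨X1, hX1, X2, hX2, Y1, hY1, Y2, hY2, d1, d2, p1, p2, p3, p4, p5, p6⟩ :=
      palette_union X Y _ _ _ _ _ _ m1 m2 n1 n2 w1 w2 (q1.trans hXY)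
        (by omega) t1 t2
    refine finish X1 hX1 X2 hX2 Y1 hY1 Y2 hY2 p1 p2 p3 p4 p5 p6 ?_
    rintro x hx y hy hxy n m a1 a2 a3 a4 rfl
    rw [hadj x hx y hy] at hxy
    rw [Finset.disjoint_left] at d1 d2
    by_cases hxA : x ∈ A
    · exact d1 (a1 hxA) (a4 (by tauto))
    · exact d2 (a3 (by tauto)) (a2 hxA)
  · have hadj : ∀ x ∈ S₁, ∀ y ∈ S₂, (G.Adj x y ↔ (x ∈ A ↔ y ∈ A)) := by
      intro x hx y hy
      have := hsp x hx y hy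
      rwa [seidel_adj (hne x hx y hy)] at this
    have q1 : cliqueMax G (S₁.filter (· ∈ A)) + cliqueMax G (S₂.filter (· ∈ A)) ≤
        cliqueMax G (S.filter (· ∈ A)) := by
      refine add_le_cliqueMax (Finset.filter_subset_filter _ hsub1)
        (Finset.filter_subset_filter _ hsub2) ?_
      intro x hx y hy
      rw [Finset.mem_filter] at hx hy
      rw [hadj x hx.1 y hy.1]; tauto
    have q2 : cliqueMax G (S₁.filter (· ∉ A)) + cliqueMax G (S₂.filter (· ∉ A)) ≤
        cliqueMax G (S.filter (· ∉ A)) := by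
      refine add_le_cliqueMax (Finset.filter_subset_filter _ hsub1)
        (Finset.filter_subset_filter _ hsub2) ?_
      intro x hx y hy
      rw [Finset.mem_filter] at hx hy
      rw [hadj x hx.1 y hy.1]; tauto
    obtain ⟨X1, hX1, X2, hX2, Y1, hY1, Y2, hY2, d1, d2, p1, p2, p3, p4, p5, p6⟩ :=
      palette_join X Y _ _ _ _ _ _ (q1.trans hX) (q2.trans hY) w1 w2 t1 t2
    refine finish X1 hX1 X2 hX2 Y1 hY1 Y2 hY2 p1 p2 p3 p4 p5 p6 ?_
    rintro x hx y hy hxy n m a1 a2 a3 a4 rfl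
    rw [hadj x hx y hy] at hxy
    rw [Finset.disjoint_left] at d1 d2
    by_cases hxA : x ∈ A
    · exact d1 (a1 hxA) (a3 (by tauto))
    · exact d2 (a2 hxA) (a4 (by tauto))

end SwitchCographProof

/-- Every switch cograph is a perfect graph. -/
theorem isSwitchCograph_perfect {V : Type*} [Fintype V] [DecidableEq V]
    (G : SimpleGraph V) (h : IsSwitchCograph G) : IsPerfect G := by
  classical
  obtain ⟨A, hA⟩ := exists_seidel G h
  intro S
  apply le_antisymm
  · have hm : ∀ x, x ∈ S.toFinset ↔ x ∈ S := by simp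
    obtain ⟨f, f1, f2, f3⟩ := colors_all G A hA S.toFinset
      (Finset.range (cliqueMax G S.toFinset)) (Finset.range (cliqueMax G S.toFinset))
      (by rw [Finset.card_range]; exact cliqueMax_mono (Finset.filter_subset _ _))
      (by rw [Finset.card_range]; exact cliqueMax_mono (Finset.filter_subset _ _))
      (by simp)
    have hlt : ∀ x ∈ S, f x < cliqueMax G S.toFinset := by
      intro x hx
      by_cases hxA : x ∈ A
      · exact Finset.mem_range.1 (f1 x ((hm x).2 hx) hxA)
      · exact Finset.mem_range.1 (f2 x ((hm x).2 hx) hxA)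
    have hcol : (G.induce S).Colorable (cliqueMax G S.toFinset) := by
      refine ⟨Coloring.mk (fun x => ⟨f x.1, hlt x.1 x.2⟩) ?_⟩
      intro x y hxy e
      exact f3 x.1 ((hm _).2 x.2) y.1 ((hm _).2 y.2) hxy (by simpa using e)
    refine hcol.chromaticNumber_le.trans ?_
    obtain ⟨t, ht, htc, e⟩ := exists_cliqueMax G S.toFinset
    refine le_sSup ⟨_, ⟨t.subtype (· ∈ S), ?_⟩, rfl⟩
    constructor
    · intro x hx y hy hxy
      simp only [Finset.mem_coe, Finset.mem_subtype] at hx hy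
      exact htc hx hy (fun e => hxy (Subtype.ext e))
    · rw [Finset.card_subtype, Finset.filter_true_of_mem, e]
      intro x hx
      exact (hm x).1 (ht hx)
  · refine sSup_le ?_
    rintro _ ⟨n, ⟨t, ht⟩, rfl⟩
    have := ht.isClique.card_le_chromaticNumber
    rw [ht.card_eq] at this
    exact this
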